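/- Let p ≥ 4 be an integer. For every real q with 0 < q < 1, Σ_{m} q^{(m·C̃m)/4} (1/(q)_{m_0}) ∏_{j=1}^{p−2} [ (½Ĩm)_j choose m_j ]_q = (1/(q)_∞) Σ_{j∈ℤ} ( q^{p(p+1)j² + j} − q^{(pj+1)((p+1)j+1)} ), where the left-hand sum runs over all m ∈ ℤ^{p−1} with nonnegative entries and m_{p−2} even, and both sides converge absolutely. The right-hand side is the Virasoro character χ^{p,p+1}_{1,1}(q). -/

import Mathlib

open Finset

noncomputable section

/-- `(q)_k = ∏_{j=1}^k (1 - q^j)`. -/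
def qPoch (q : ℝ) (k : ℕ) : ℝ := ∏ j ∈ Finset.range k, (1 - q ^ (j + 1))

/-- The Andrews–Baxter `q`-trinomial coefficient `T^n(L,A)`. -/
def qTri (q : ℝ) (n : ℤ) (L : ℕ) (A : ℤ) : ℝ :=
  if |A| ≤ (L : ℤ) then
    ∑ j ∈ Finset.range (L + 1),
      if 0 ≤ (j : ℤ) + A ∧ 0 ≤ (L : ℤ) - 2 * j - A then
        q ^ ((j : ℤ) * ((j : ℤ) + A - n)) * qPoch q L /
          (qPoch q j * qPoch q (((j : ℤ) + A).toNat) * qPoch q (((L : ℤ) - 2 * j - A).toNat))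
      else 0
  else 0

/-- Bosonic polynomial `B^p_{a,b}(L,s)`. -/
def Bpoly (q : ℝ) (p a b s : ℤ) (L : ℕ) : ℝ :=
  ∑' j : ℤ,
    (q ^ (p * (p + 1) * j ^ 2 + j * ((p + 1) * a - p * s)) * qTri q 0 L (2 * p * j + a - b)
      - q ^ ((p * j + a) * ((p + 1) * j + s)) * qTri q 0 L (2 * p * j + a + b))

/-- Bosonic polynomial `B̃^p_{a,b}(L,s)`. -/
def Btpoly (q : ℝ) (p a b s : ℤ) (L : ℕ) : ℝ :=
  ∑' j : ℤ,
    (q ^ (p * (p + 1) * j ^ 2 + j * ((p + 1) * a - p * s)) * qTri q 1 L (2 * p * j + a - b)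
      - q ^ (p * (p + 1) * j ^ 2 + j * ((p + 1) * a + p * (s - 2)) + a * (s - 1) - b)
        * qTri q 1 L (2 * p * j + a + b))

/-- `(q)_∞`. -/
def qPochInf (q : ℝ) : ℝ := ∏' j : ℕ, (1 - q ^ (j + 1))

/-- The matrix `Ĩ_{p-1}`. -/
def ItM (p : ℕ) (i j : Fin (p - 1)) : ℚ :=
  if i.val = 0 then (if j.val = 2 then -1 else 0)
  else if j.val = 0 then (if i.val = 2 then 1 else 0)
  else if i.val = j.val + 1 ∨ j.val = i.val + 1 then 1 else 0

/-- The matrix `C̃_{p-1} = 2·Id - Ĩ_{p-1}`. -/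
def CtM (p : ℕ) (i j : Fin (p - 1)) : ℚ := (if i = j then 2 else 0) - ItM p i j

/-- Unit vector `e_c` (zero if `c` is out of range). -/
def evec (p c : ℕ) : Fin (p - 1) → ℚ := fun i => if i.val = c then 1 else 0

/-- Kronecker delta. -/
def kdel (a b : ℕ) : ℕ := if a = b then 1 else 0

/-- `p̃(n) = 1` if `n` is odd, `0` otherwise. -/
def ptil (n : ℕ) : ℚ := if n % 2 = 1 then 1 else 0

/-- The vector `u^i_{a,b}`. -/
def uvec (p i a b : ℕ) : Fin (p - 1) → ℚ := fun j =>
  (if 1 < a then evec p a j else 0) + (if 1 < b then evec p b j else 0)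
    + ptil (a + kdel a 1 + b + kdel b 1 + (if i = 1 then p - 1 else 0)) * (evec p 1 j - evec p 0 j)

/-- The vector `A^i_{a,b}`. -/
def Avec (p i a b : ℕ) : Fin (p - 1) → ℚ := fun j =>
  (if 1 < b then evec p b j else 0)
    + ptil (a + kdel a 1 + b + kdel b 1 + (if i = 1 then p - 1 else 0)) * evec p 1 j

/-- `q`-binomial coefficient with (possibly non-integral) rational top entry:
it vanishes unless the top is an integer `N` with `0 ≤ m ≤ N`. -/
def qBinQ (q : ℝ) (N : ℚ) (m : ℕ) : ℝ :=
  if N.den = 1 ∧ (m : ℚ) ≤ N then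
    qPoch q N.num.toNat / (qPoch q m * qPoch q (N.num.toNat - m))
  else 0

/-- The quadratic form `Φ(m) = (m·C̃m)/4 - (A·m)/2`. -/
def PhiQ (p : ℕ) (A : Fin (p - 1) → ℚ) (m : Fin (p - 1) → ℕ) : ℚ :=
  (∑ i, ∑ j, (m i : ℚ) * CtM p i j * (m j : ℚ)) / 4 - (∑ j, A j * (m j : ℚ)) / 2

/-- The vector `(½ Ĩ m + L e₀ + ½ u)`. -/
def topVec (p L : ℕ) (u : Fin (p - 1) → ℚ) (m : Fin (p - 1) → ℕ) (i : Fin (p - 1)) : ℚ :=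
  (∑ j, ItM p i j * (m j : ℚ)) / 2 + (L : ℚ) * evec p 0 i + u i / 2

/-- The last component `m_{p-2}`. -/
def mlast (p : ℕ) (m : Fin (p - 1) → ℕ) : ℕ :=
  if h : p - 1 ≠ 0 then m ⟨p - 2, by omega⟩ else 0

/-- The fundamental fermionic form `f^p_k(L; u; A)`. -/
def fFerm (q : ℝ) (p k L : ℕ) (u A : Fin (p - 1) → ℚ) : ℝ :=
  ∑' m : Fin (p - 1) → ℕ,
    if mlast p m % 2 = k % 2 then
      q ^ ((PhiQ p A m : ℝ)) * ∏ i, qBinQ q (topVec p L u m i) (m i)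
    else 0

/-- The fermionic polynomial `F^{p,i}_{a,b}(L)`. -/
def Fpoly (q : ℝ) (p i a b L : ℕ) : ℝ :=
  if b = p - 1 then fFerm q p (1 - i) L (uvec p i a b) (Avec p i a b)
  else fFerm q p i L (uvec p i a b) (Avec p i a b)

def phiR (a b : ℝ) : ℝ := (b - a) * (b - a + 1) / 4

def phitR (a b : ℝ) : ℝ := (b - a) * (b - a + 3) / 4

/-- Virasoro character `χ^{p,p+1}_{r,s}(q)` of the minimal model `M(p,p+1)`. -/
def chiV (p r s : ℤ) (q : ℝ) : ℝ :=
  (∑' j : ℤ, (q ^ (p * (p + 1) * j ^ 2 + j * ((p + 1) * r - p * s))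
      - q ^ ((p * j + r) * ((p + 1) * j + s)))) / qPochInf q

/-! ### Gaussian binomials with integer arguments -/

/-- Gaussian binomial with integer entries. -/
def qb (q : ℝ) (n k : ℤ) : ℝ :=
  if 0 ≤ k ∧ k ≤ n then
    qPoch q n.toNat / (qPoch q k.toNat * qPoch q (n - k).toNat) else 0

lemma qPoch_pos {q : ℝ} (hq0 : 0 < q) (hq1 : q < 1) (k : ℕ) : 0 < qPoch q k := by
  unfold qPoch
  refine Finset.prod_pos fun j _ => ?_
  have := pow_lt_one₀ hq0.le hq1 (Nat.succ_ne_zero j)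
  simpa using this

lemma qPoch_succ (q : ℝ) (k : ℕ) : qPoch q (k + 1) = qPoch q k * (1 - q ^ (k + 1)) := by
  simp [qPoch, Finset.prod_range_succ]

lemma qPoch_zero (q : ℝ) : qPoch q 0 = 1 := by simp [qPoch]

lemma qb_nonneg {q : ℝ} (hq0 : 0 < q) (hq1 : q < 1) (n k : ℤ) : 0 ≤ qb q n k := by
  unfold qb
  split_ifs
  · exact div_nonneg (qPoch_pos hq0 hq1 _).le
      (mul_pos (qPoch_pos hq0 hq1 _) (qPoch_pos hq0 hq1 _)).le
  · exact le_rfl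

lemma qb_zero (q : ℝ) {n k : ℤ} (h : ¬ (0 ≤ k ∧ k ≤ n)) : qb q n k = 0 := by
  unfold qb; rw [if_neg h]

lemma qb_nat (q : ℝ) (a b : ℕ) :
    qb q ((a : ℤ) + b) a = qPoch q (a + b) / (qPoch q a * qPoch q b) := by
  unfold qb
  rw [if_pos ⟨by omega, by omega⟩]
  congr 2
  congr 1
  omega

lemma qb_symm (q : ℝ) (n k : ℤ) : qb q n k = qb q n (n - k) := by
  by_cases h : 0 ≤ k ∧ k ≤ n
  · obtain ⟨a, rfl⟩ := Int.eq_ofNat_of_zero_le h.1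
    obtain ⟨b, hb⟩ := Int.eq_ofNat_of_zero_le (sub_nonneg.2 h.2)
    obtain rfl : n = (a : ℤ) + b := by omega
    rw [qb_nat, show (a : ℤ) + b - a = b by ring, add_comm (a : ℤ), qb_nat, mul_comm, add_comm]
  · rw [qb_zero q h, qb_zero q (by omega)]

lemma qb_self {q : ℝ} (hq0 : 0 < q) (hq1 : q < 1) {n : ℤ} (hn : 0 ≤ n) : qb q n n = 1 := by
  obtain ⟨a, rfl⟩ := Int.eq_ofNat_of_zero_le hn
  have := qb_nat q a 0
  have h := (qPoch_pos hq0 hq1 a).ne'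
  simp [qPoch_zero] at this
  rw [this, div_self h]

lemma qb_bot {q : ℝ} (hq0 : 0 < q) (hq1 : q < 1) {n : ℤ} (hn : 0 ≤ n) : qb q n 0 = 1 := by
  rw [qb_symm, sub_zero, qb_self hq0 hq1 hn]

lemma qb_pascal {q : ℝ} (hq0 : 0 < q) (hq1 : q < 1) {n : ℤ} (hn : 0 ≤ n) (k : ℤ) :
    qb q (n + 1) k = qb q n (k - 1) + q ^ k * qb q n k := by
  rcases lt_trichotomy k 0 with hk | rfl | hk
  · rw [qb_zero q (by omega), qb_zero q (by omega), qb_zero q (by omega)]; simp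
  · rw [qb_bot hq0 hq1 (by omega), qb_bot hq0 hq1 hn, qb_zero q (by omega)]; simp
  · rcases lt_trichotomy k (n + 1) with h | rfl | h
    · obtain ⟨a, ha⟩ := Int.eq_ofNat_of_zero_le (show 0 ≤ k - 1 by omega)
      obtain ⟨b, hb⟩ := Int.eq_ofNat_of_zero_le (show 0 ≤ n - k by omega)
      obtain rfl : k = ((a + 1 : ℕ) : ℤ) := by push_cast; omega
      obtain rfl : n = ((a + 1 : ℕ) : ℤ) + b := by omega
      rw [show ((a + 1 : ℕ) : ℤ) + b + 1 = ((a + 1 : ℕ) : ℤ) + ((b + 1 : ℕ) : ℤ) by push_cast; ring,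
        qb_nat, qb_nat,
        show ((a + 1 : ℕ) : ℤ) + b = (a : ℤ) + ((b + 1 : ℕ) : ℤ) by push_cast; ring,
        show ((a + 1 : ℕ) : ℤ) - 1 = a by push_cast; ring, qb_nat,
        show a + 1 + (b + 1) = (a + b + 1) + 1 by ring, show a + (b + 1) = a + b + 1 by ring,
        show a + 1 + b = a + b + 1 by ring, qPoch_succ q (a + b + 1), qPoch_succ q a,
        qPoch_succ q b, zpow_natCast]
      have h1 := (qPoch_pos hq0 hq1 a).ne'
      have h2 := (qPoch_pos hq0 hq1 b).ne'
      have h3 : 1 - q ^ (a + 1) ≠ 0 := by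
        have := pow_lt_one₀ hq0.le hq1 (Nat.succ_ne_zero a)
        simp only [Nat.succ_eq_add_one] at this
        linarith
      have h4 : 1 - q ^ (b + 1) ≠ 0 := by
        have := pow_lt_one₀ hq0.le hq1 (Nat.succ_ne_zero b)
        simp only [Nat.succ_eq_add_one] at this
        linarith
      field_simp
      ring
    · rw [qb_self hq0 hq1 (by omega), show n + 1 - 1 = n by ring, qb_self hq0 hq1 hn,
        qb_zero q (by omega)]; simp
    · rw [qb_zero q (by omega), qb_zero q (by omega), qb_zero q (by omega)]; simp

/-- Trinomial revision. -/
lemma qb_rev {q : ℝ} (hq0 : 0 < q) (hq1 : q < 1) (n t k : ℤ) :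
    qb q n t * qb q t k = qb q n k * qb q (n - k) (t - k) := by
  by_cases h : 0 ≤ k ∧ k ≤ t ∧ t ≤ n
  · obtain ⟨a, rfl⟩ := Int.eq_ofNat_of_zero_le h.1
    obtain ⟨b, hb⟩ := Int.eq_ofNat_of_zero_le (sub_nonneg.2 h.2.1)
    obtain ⟨c, hc⟩ := Int.eq_ofNat_of_zero_le (sub_nonneg.2 h.2.2)
    obtain rfl : t = (a : ℤ) + b := by omega
    obtain rfl : n = (a : ℤ) + b + c := by omega
    rw [qb_nat, show (a : ℤ) + b - a = b by ring, show (a : ℤ) + b + c - a = b + c by ring, qb_nat,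
      show (a : ℤ) + b + c = ((a + b : ℕ) : ℤ) + c by push_cast; ring,
      show (a : ℤ) + b = ((a + b : ℕ) : ℤ) by push_cast; ring, qb_nat,
      show ((a + b : ℕ) : ℤ) + c = a + ((b + c : ℕ) : ℤ) by push_cast; ring, qb_nat, add_assoc]
    have h1 := (qPoch_pos hq0 hq1 a).ne'
    have h2 := (qPoch_pos hq0 hq1 b).ne'
    have h3 := (qPoch_pos hq0 hq1 c).ne'
    have h4 := (qPoch_pos hq0 hq1 (a + b)).ne'
    have h5 := (qPoch_pos hq0 hq1 (b + c)).ne'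
    field_simp
  · have : qb q n t * qb q t k = 0 := by
      by_cases h1 : 0 ≤ t ∧ t ≤ n
      · rw [qb_zero q (n := t) (k := k) (by omega), mul_zero]
      · rw [qb_zero q h1, zero_mul]
    rw [this]
    by_cases h1 : 0 ≤ k ∧ k ≤ n
    · rw [qb_zero q (n := n - k) (by omega), mul_zero]
    · rw [qb_zero q h1, zero_mul]

lemma summable_of_window {f : ℤ → ℝ} (A B : ℤ) (h : ∀ s, f s ≠ 0 → A ≤ s ∧ s ≤ B) :
    Summable f := by
  apply summable_of_hasFiniteSupport
  exact (Set.finite_Icc A B).subset fun s hs => h s hs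

lemma qb_ne {q : ℝ} {n k : ℤ} (h : qb q n k ≠ 0) : 0 ≤ k ∧ k ≤ n := by
  by_contra h'
  exact h (qb_zero q h')

/-- q-Vandermonde. -/
lemma vand {q : ℝ} (hq0 : 0 < q) (hq1 : q < 1) (m : ℕ) {n : ℤ} (hn : 0 ≤ n) (r : ℤ) :
    ∑' s : ℤ, q ^ (((m : ℤ) - s) * (r - s)) * qb q m s * qb q n (r - s) = qb q (m + n) r := by
  induction m generalizing r with
  | zero =>
    rw [tsum_eq_single 0]
    · simp [qb_bot hq0 hq1 le_rfl]
    · intro s hs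
      rw [qb_zero q (n := ((0 : ℕ) : ℤ)) (k := s) (by push_cast; omega)]; simp
  | succ m ih =>
    have key : ∀ s : ℤ, q ^ ((((m + 1 : ℕ) : ℤ) - s) * (r - s)) * qb q ((m + 1 : ℕ) : ℤ) s
          * qb q n (r - s) =
        q ^ (((m : ℤ) - (s - 1)) * ((r - 1) - (s - 1))) * qb q m (s - 1) * qb q n ((r - 1) - (s - 1))
        + q ^ r * (q ^ (((m : ℤ) - s) * (r - s)) * qb q m s * qb q n (r - s)) := by
      intro s
      have e : q ^ r * (q ^ (((m : ℤ) - s) * (r - s)) * qb q m s * qb q n (r - s))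
          = q ^ ((((m : ℤ) + 1) - s) * (r - s)) * (q ^ s * qb q m s) * qb q n (r - s) := by
        rw [← mul_assoc, ← mul_assoc, ← zpow_add₀ hq0.ne', ← mul_assoc, ← zpow_add₀ hq0.ne']
        congr 3
        ring
      rw [e]
      push_cast
      rw [qb_pascal hq0 hq1 (by omega : (0 : ℤ) ≤ m), show r - 1 - (s - 1) = r - s by ring,
        show (m : ℤ) - (s - 1) = m + 1 - s by ring]
      ring
    have hs : ∀ r : ℤ, Summable fun s : ℤ =>
        q ^ (((m : ℤ) - s) * (r - s)) * qb q m s * qb q n (r - s) := by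
      intro r
      refine summable_of_window 0 m fun s hs => qb_ne (q := q) ?_
      intro h0; apply hs; rw [h0]; simp
    have hs1 : Summable fun s : ℤ =>
        q ^ (((m : ℤ) - (s - 1)) * ((r - 1) - (s - 1))) * qb q m (s - 1)
          * qb q n ((r - 1) - (s - 1)) := by
      refine summable_of_window 1 (m + 1) fun s hs => ?_
      have := qb_ne (q := q) (n := (m : ℤ)) (k := s - 1) (by
        intro h0; apply hs; rw [h0]; simp)
      omega
    rw [tsum_congr key, hs1.tsum_add ((hs r).mul_left _), tsum_mul_left, ih r]
    have := (Equiv.subRight (1 : ℤ)).tsum_eq (fun s : ℤ =>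
        q ^ (((m : ℤ) - s) * ((r - 1) - s)) * qb q m s * qb q n ((r - 1) - s))
    simp only [Equiv.subRight_apply] at this
    rw [this, ih (r - 1), show (((m + 1 : ℕ) : ℤ) + n) = (m + n) + 1 by push_cast; ring,
      qb_pascal hq0 hq1 (by omega)]

lemma vand' {q : ℝ} (hq0 : 0 < q) (hq1 : q < 1) {m n : ℤ} (hm : 0 ≤ m) (hn : 0 ≤ n) (c : ℤ) :
    ∑' k : ℤ, q ^ (k * (k + c)) * qb q m k * qb q n (k + c) = qb q (m + n) (m + c) := by
  obtain ⟨m, rfl⟩ := Int.eq_ofNat_of_zero_le hm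
  rw [← vand hq0 hq1 m hn, ← (Equiv.subLeft (m : ℤ)).tsum_eq]
  refine tsum_congr fun k => ?_
  simp only [Equiv.subLeft_apply]
  rw [← qb_symm, show (m : ℤ) - k + c = m + c - k by ring]

/-- q-Saalschütz. -/
lemma saal {q : ℝ} (hq0 : 0 < q) (hq1 : q < 1) {P Q : ℤ} (hP : 0 ≤ P) (hQ : 0 ≤ Q) (M c : ℤ) :
    ∑' k : ℤ, q ^ (k * (k + c)) * qb q (P + Q + M - k) (M - k) * qb q P k * qb q Q (k + c)
      = qb q (P + M + c) M * qb q (Q + M) (M + c) := by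
  by_cases hM : 0 ≤ M
  swap
  · rw [qb_zero q (n := P + M + c) (k := M) (by omega), zero_mul]
    refine (tsum_congr fun k => ?_).trans tsum_zero
    by_cases hk : 0 ≤ k
    · rw [qb_zero q (k := M - k) (by omega)]; simp
    · rw [qb_zero q (n := P) (k := k) (by omega)]; simp
  let G : ℤ → ℤ → ℝ := fun k t =>
    q ^ (k * (k + c)) * q ^ ((P - t) * (M - t)) * qb q P t * qb q t k * qb q (Q + M) (M - t)
      * qb q Q (k + c)
  have h1 : ∀ k : ℤ, q ^ (k * (k + c)) * qb q (P + Q + M - k) (M - k) * qb q P k * qb q Q (k + c)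
      = ∑' t, G k t := by
    intro k
    by_cases hk : 0 ≤ k ∧ k ≤ P
    swap
    · rw [qb_zero q hk]
      symm
      simp only [mul_zero, zero_mul]
      refine (tsum_congr fun t => ?_).trans tsum_zero
      simp only [G]
      rw [mul_assoc (q ^ (k * (k + c)) * q ^ ((P - t) * (M - t))), qb_rev hq0 hq1, qb_zero q hk]
      simp
    obtain ⟨m, hm⟩ := Int.eq_ofNat_of_zero_le (sub_nonneg.2 hk.2)
    rw [show P + Q + M - k = (m : ℤ) + (Q + M) by omega, ← vand hq0 hq1 m (by omega),
      ← (Equiv.subRight k).tsum_eq, ← tsum_mul_left, ← tsum_mul_right, ← tsum_mul_right]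
    refine tsum_congr fun t => ?_
    simp only [Equiv.subRight_apply, G]
    rw [mul_assoc (q ^ (k * (k + c)) * q ^ ((P - t) * (M - t))), qb_rev hq0 hq1, ← hm,
      show P - k - (t - k) = P - t by ring, show M - k - (t - k) = M - t by ring]
    ring
  rw [tsum_congr h1]
  have hsum : Summable (Function.uncurry G) := by
    apply summable_of_hasFiniteSupport
    refine ((Set.finite_Icc 0 P).prod (Set.finite_Icc 0 P)).subset ?_
    rintro ⟨k, t⟩ h
    simp only [Function.mem_support, Function.uncurry, G] at h
    have a1 : qb q P t ≠ 0 := by rintro h0; apply h; rw [h0]; simp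
    have a2 : qb q t k ≠ 0 := by rintro h0; apply h; rw [h0]; simp
    have := qb_ne a1
    have := qb_ne a2
    simp only [Set.mem_prod, Set.mem_Icc]
    omega
  rw [← hsum.tsum_comm]
  have h2 : ∀ t : ℤ, ∑' k, G k t = qb q (Q + M) (M + c) *
      (q ^ ((P - t) * (M - t)) * qb q P t * qb q (M + c) (M - t)) := by
    intro t
    by_cases ht : 0 ≤ t
    swap
    · rw [qb_zero q (n := P) (k := t) (by omega)]
      simp only [mul_zero, zero_mul]
      refine (tsum_congr fun k => ?_).trans tsum_zero
      simp only [G]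
      rw [qb_zero q (n := P) (k := t) (by omega)]; simp
    have e : ∀ k, G k t = (q ^ ((P - t) * (M - t)) * qb q P t * qb q (Q + M) (M - t)) *
        (q ^ (k * (k + c)) * qb q t k * qb q Q (k + c)) := by
      intro k; simp only [G]; ring
    rw [tsum_congr e, tsum_mul_left, vand' hq0 hq1 ht hQ]
    have r1 := qb_rev hq0 hq1 (Q + M) (Q + t) (Q - c)
    rw [qb_symm q (Q + M) (Q + t), qb_symm q (Q + t), qb_symm q (Q + M) (Q - c),
      qb_symm q (Q + M - (Q - c)),
      show Q + M - (Q + t) = M - t by ring, show Q + t - (Q - c) = t + c by ring,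
      show Q + M - (Q - c) = M + c by ring, show M + c - (t + c) = M - t by ring] at r1
    rw [add_comm t Q]
    linear_combination (q ^ ((P - t) * (M - t)) * qb q P t) * r1
  rw [tsum_congr h2, tsum_mul_left]
  by_cases hc : 0 ≤ M + c
  · obtain ⟨m, rfl⟩ := Int.eq_ofNat_of_zero_le hP
    rw [vand hq0 hq1 m hc, mul_comm, add_assoc]
  · rw [qb_zero q (n := Q + M) (k := M + c) (by omega)]; simp
/-! ### The Burge transform -/

/-- The doubly bounded kernel. -/
def SS (q : ℝ) (L M a b : ℤ) : ℝ := qb q (L + M + a - b) (L + a) * qb q (L + M - a + b) (L - a)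

lemma tsum_int_range {f : ℤ → ℝ} (L : ℕ) (h : ∀ s, f s ≠ 0 → 0 ≤ s ∧ s ≤ L) :
    ∑' s, f s = ∑ i ∈ Finset.range (L + 1), f (i : ℤ) := by
  rw [tsum_eq_sum (s := (Finset.range (L + 1)).map Nat.castEmbedding), Finset.sum_map]
  · rfl
  · intro s hs
    by_contra h0
    have := h s h0
    apply hs
    simp only [Finset.mem_map, Finset.mem_range, Nat.castEmbedding_apply]
    exact ⟨s.toNat, by omega, by omega⟩

lemma SS_kernel (q : ℝ) (L i a b : ℤ) :
    SS q (L - i) i a b = qb q (L + a - b) (i - b) * qb q (L - a + b) (i + b) := by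
  unfold SS
  rw [qb_symm q (L - i + i + a - b), qb_symm q (L - i + i - a + b)]
  congr 2 <;> ring

lemma SS_ne {q : ℝ} {L M a b : ℤ} (h : SS q L M a b ≠ 0) : -L ≤ a ∧ a ≤ L := by
  unfold SS at h
  have h1 := qb_ne (left_ne_zero_of_mul h)
  have h2 := qb_ne (right_ne_zero_of_mul h)
  omega

lemma burge {q : ℝ} (hq0 : 0 < q) (hq1 : q < 1) (L M : ℕ) (a b : ℤ)
    (h : (0 ≤ L + a - b ∧ 0 ≤ L - a + b) ∨ L + a + b < 0 ∨ L - a - b < 0) :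
    ∑ i ∈ Finset.range (L + 1), q ^ ((i : ℤ) ^ 2) * qb q (2 * L + M - i) (2 * L)
      * SS q (L - i) i a b = q ^ (b ^ 2) * SS q L M (a + b) b := by
  have hR : SS q L M (a + b) b = qb q (L + a - b + (M - b) + 2 * b) (M - b) *
      qb q (L - a + b + (M - b)) (M - b + 2 * b) := by
    unfold SS
    rw [qb_symm q (L + M + (a + b) - b), qb_symm q (L + M - (a + b) + b)]
    congr 2 <;> ring
  by_cases hPQ : 0 ≤ L + a - b ∧ 0 ≤ L - a + b
  · rw [hR, ← saal hq0 hq1 hPQ.1 hPQ.2, ← tsum_mul_left, ← (Equiv.subRight b).tsum_eq]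
    simp only [Equiv.subRight_apply]
    rw [tsum_int_range L]
    · refine Finset.sum_congr rfl fun i _ => ?_
      rw [SS_kernel, qb_symm q (2 * L + M - i), show (i : ℤ) - b + 2 * b = i + b by ring,
        show (L : ℤ) + a - b + (L - a + b) + (M - b) - (i - b) = 2 * L + M - i by ring,
        show (M : ℤ) - b - (i - b) = 2 * L + M - i - 2 * L by ring,
        show (i : ℤ) ^ 2 = b ^ 2 + (i - b) * (i + b) by ring, zpow_add₀ hq0.ne']
      ring
    · intro s hs
      have a1 := qb_ne (q := q) (n := L + a - b) (k := s - b) (by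
        intro h0; apply hs; rw [h0]; simp)
      have a2 := qb_ne (q := q) (n := L - a + b) (k := s - b + 2 * b) (by
        intro h0; apply hs; rw [h0]; simp)
      omega
  · have hz : SS q L M (a + b) b = 0 := by
      by_contra h0
      have := SS_ne h0
      omega
    rw [hz, mul_zero]
    refine Finset.sum_eq_zero fun i _ => ?_
    rw [SS_kernel]
    by_cases hP : 0 ≤ L + a - b
    · rw [qb_zero q (n := L - a + b) (by omega)]; simp
    · rw [qb_zero q (n := L + a - b) (by omega)]; simp

lemma burgeInf {q : ℝ} (hq0 : 0 < q) (hq1 : q < 1) (L : ℕ) (a b : ℤ)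
    (h : (0 ≤ L + a - b ∧ 0 ≤ L - a + b) ∨ L + a + b < 0 ∨ L - a - b < 0) :
    ∑ i ∈ Finset.range (L + 1), q ^ ((i : ℤ) ^ 2) * SS q (L - i) i a b
      = q ^ (b ^ 2) * qb q (2 * L) (L + (a + b)) := by
  by_cases hPQ : 0 ≤ L + a - b ∧ 0 ≤ L - a + b
  · rw [show (2 * L : ℤ) = L + a - b + (L - a + b) by ring,
      show L + (a + b) = L + a - b + 2 * b by ring,
      ← vand' hq0 hq1 hPQ.1 hPQ.2, ← tsum_mul_left, ← (Equiv.subRight b).tsum_eq]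
    simp only [Equiv.subRight_apply]
    rw [tsum_int_range L]
    · refine Finset.sum_congr rfl fun i _ => ?_
      rw [SS_kernel, show (i : ℤ) - b + 2 * b = i + b by ring,
        show (i : ℤ) ^ 2 = b ^ 2 + (i - b) * (i + b) by ring, zpow_add₀ hq0.ne']
      ring
    · intro s hs
      have a1 := qb_ne (q := q) (n := L + a - b) (k := s - b) (by
        intro h0; apply hs; rw [h0]; simp)
      have a2 := qb_ne (q := q) (n := L - a + b) (k := s - b + 2 * b) (by
        intro h0; apply hs; rw [h0]; simp)
      omega
  · rw [qb_zero q (n := 2 * L) (by omega), mul_zero]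
    refine Finset.sum_eq_zero fun i _ => ?_
    rw [SS_kernel]
    by_cases hP : 0 ≤ L + a - b
    · rw [qb_zero q (n := L - a + b) (by omega)]; simp
    · rw [qb_zero q (n := L + a - b) (by omega)]; simp

/-- The bosonic polynomials. -/
def DD (q : ℝ) (k L M : ℤ) : ℝ :=
  ∑' j : ℤ, q ^ (j * (k * j + 1)) * (SS q L M (k * j) j - SS q L M (k * j + 1) j)

lemma side1 {k : ℤ} (hk : 1 ≤ k) (L : ℕ) (j : ℤ) :
    (0 ≤ L + k * j - j ∧ 0 ≤ L - k * j + j) ∨ L + k * j + j < 0 ∨ L - k * j - j < 0 := by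
  obtain ⟨k, rfl⟩ : ∃ k', k = k' + 1 := ⟨k - 1, by ring⟩
  rcases le_or_gt 0 j with hj | hj
  · have : 0 ≤ k * j := mul_nonneg (by omega) hj
    rw [add_mul]; omega
  · have : k * j ≤ 0 := mul_nonpos_of_nonneg_of_nonpos (by omega) hj.le
    rw [add_mul]; omega

lemma side2 {k : ℤ} (hk : 1 ≤ k) (L : ℕ) (j : ℤ) :
    (0 ≤ L + (k * j + 1) - j ∧ 0 ≤ L - (k * j + 1) + j) ∨
      L + (k * j + 1) + j < 0 ∨ L - (k * j + 1) - j < 0 := by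
  obtain ⟨k, rfl⟩ : ∃ k', k = k' + 1 := ⟨k - 1, by ring⟩
  rcases le_or_gt 0 j with hj | hj
  · have : 0 ≤ k * j := mul_nonneg (by omega) hj
    rw [add_mul]; omega
  · have : k * j ≤ 0 := mul_nonpos_of_nonneg_of_nonpos (by omega) hj.le
    rw [add_mul]; omega

lemma DD_window {k : ℤ} (hk : 1 ≤ k) (L : ℤ) (j : ℤ)
    (h : (-L ≤ k * j ∧ k * j ≤ L) ∨ (-L ≤ k * j + 1 ∧ k * j + 1 ≤ L)) :
    -L - 1 ≤ j ∧ j ≤ L := by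
  obtain ⟨k, rfl⟩ : ∃ k', k = k' + 1 := ⟨k - 1, by ring⟩
  rcases le_or_gt 0 j with hj | hj
  · have : 0 ≤ k * j := mul_nonneg (by omega) hj
    rw [add_mul] at h; omega
  · have : k * j ≤ 0 := mul_nonpos_of_nonneg_of_nonpos (by omega) hj.le
    rw [add_mul] at h; omega

lemma DD_summable {k : ℤ} (hk : 1 ≤ k) (q : ℝ) (L M : ℤ) :
    Summable fun j : ℤ => q ^ (j * (k * j + 1)) * (SS q L M (k * j) j - SS q L M (k * j + 1) j) := by
  refine summable_of_window (-L - 1) L fun j hj => DD_window hk L j ?_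
  by_cases h1 : SS q L M (k * j) j = 0
  · have h2 : SS q L M (k * j + 1) j ≠ 0 := by
      intro h0; apply hj; rw [h1, h0]; simp
    exact Or.inr (SS_ne h2)
  · exact Or.inl (SS_ne h1)

lemma DD_step {q : ℝ} (hq0 : 0 < q) (hq1 : q < 1) {k : ℤ} (hk : 1 ≤ k) (L M : ℕ) :
    DD q (k + 1) L M = ∑ i ∈ Finset.range (L + 1), q ^ ((i : ℤ) ^ 2)
      * qb q (2 * L + M - i) (2 * L) * DD q k (L - i) i := by
  unfold DD
  simp_rw [← tsum_mul_left]
  rw [← Summable.tsum_finsetSum fun i _ => (DD_summable hk q _ _).mul_left _]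
  refine tsum_congr fun j => ?_
  have b1 := burge hq0 hq1 L M (k * j) j (side1 hk L j)
  have b2 := burge hq0 hq1 L M (k * j + 1) j (side2 hk L j)
  rw [show k * j + j = (k + 1) * j by ring] at b1
  rw [show k * j + 1 + j = (k + 1) * j + 1 by ring] at b2
  rw [show j * ((k + 1) * j + 1) = j * (k * j + 1) + j ^ 2 by ring, zpow_add₀ hq0.ne', mul_assoc,
    mul_sub, ← b1, ← b2, ← Finset.sum_sub_distrib, Finset.mul_sum]
  refine Finset.sum_congr rfl fun i _ => ?_
  ring

/-- The singly bounded bosonic polynomial. -/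
def HH (q : ℝ) (k L : ℤ) : ℝ :=
  ∑' j : ℤ, q ^ (j * (k * j + 1)) * (qb q (2 * L) (L + k * j) - qb q (2 * L) (L + (k * j + 1)))

lemma HH_eq {q : ℝ} (hq0 : 0 < q) (hq1 : q < 1) {k : ℤ} (hk : 1 ≤ k) (L : ℕ) :
    HH q (k + 1) L = ∑ i ∈ Finset.range (L + 1), q ^ ((i : ℤ) ^ 2) * DD q k (L - i) i := by
  unfold DD HH
  simp_rw [← tsum_mul_left]
  rw [← Summable.tsum_finsetSum fun i _ => (DD_summable hk q _ _).mul_left _]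
  refine tsum_congr fun j => ?_
  have b1 := burgeInf hq0 hq1 L (k * j) j (side1 hk L j)
  have b2 := burgeInf hq0 hq1 L (k * j + 1) j (side2 hk L j)
  rw [show k * j + j = (k + 1) * j by ring] at b1
  rw [show k * j + 1 + j = (k + 1) * j + 1 by ring] at b2
  rw [show j * ((k + 1) * j + 1) = j * (k * j + 1) + j ^ 2 by ring, zpow_add₀ hq0.ne', mul_assoc,
    mul_sub, ← b1, ← b2, ← Finset.sum_sub_distrib, Finset.mul_sum]
  refine Finset.sum_congr rfl fun i _ => ?_
  ring

lemma DD_one {q : ℝ} (hq0 : 0 < q) (hq1 : q < 1) {L M : ℤ} (hL : 0 ≤ L) (hM : 0 ≤ M)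
    (h : 1 ≤ L + M) : DD q 1 L M = 0 := by
  let g : ℤ → ℝ := fun j => q ^ (j ^ 2 + L) * (qb q (L + M) (L + j) * qb q (L + M - 1) (L - j))
  have hg : Summable g := by
    refine summable_of_window (-L) L fun j hj => ?_
    have a1 := qb_ne (left_ne_zero_of_mul (right_ne_zero_of_mul hj))
    have a2 := qb_ne (right_ne_zero_of_mul (right_ne_zero_of_mul hj))
    omega
  have hg1 : Summable fun j => g (j + 1) := by
    refine summable_of_window (-L - 1) L fun j hj => ?_
    have a1 := qb_ne (left_ne_zero_of_mul (right_ne_zero_of_mul hj))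
    have a2 := qb_ne (right_ne_zero_of_mul (right_ne_zero_of_mul hj))
    omega
  have key : ∀ j : ℤ, q ^ (j * (1 * j + 1)) * (SS q L M (1 * j) j - SS q L M (1 * j + 1) j)
      = g j - g (j + 1) := by
    intro j
    simp only [SS, g]
    have p1 := qb_pascal hq0 hq1 (n := L + M - 1) (by omega) (L - j)
    have p2 := qb_pascal hq0 hq1 (n := L + M) (by omega) (L + j + 1)
    rw [show L + M - 1 + 1 = L + M by ring] at p1
    rw [show L + j + 1 - 1 = L + j by ring] at p2
    rw [show L + M + 1 * j - j = L + M by ring, show L + M - 1 * j + j = L + M by ring,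
      show L + M + (1 * j + 1) - j = L + M + 1 by ring,
      show L + M - (1 * j + 1) + j = L + M - 1 by ring, show L + (1 * j + 1) = L + j + 1 by ring,
      show L - (1 * j + 1) = L - j - 1 by ring, one_mul, show L + (j + 1) = L + j + 1 by ring,
      show L - (j + 1) = L - j - 1 by ring, p1, p2]
    have e1 : q ^ (j ^ 2 + L) = q ^ (j * (j + 1)) * q ^ (L - j) := by
      rw [← zpow_add₀ hq0.ne']; congr 1; ring
    have e2 : q ^ ((j + 1) ^ 2 + L) = q ^ (j * (j + 1)) * q ^ (L + j + 1) := by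
      rw [← zpow_add₀ hq0.ne']; congr 1; ring
    rw [e1, e2]
    ring
  unfold DD
  rw [tsum_congr key, hg.tsum_sub hg1]
  have := (Equiv.addRight (1 : ℤ)).tsum_eq g
  simp only [Equiv.coe_addRight] at this
  rw [this, sub_self]

lemma DD_one_zero {q : ℝ} (hq0 : 0 < q) (hq1 : q < 1) : DD q 1 0 0 = 1 := by
  unfold DD
  rw [tsum_eq_single 0]
  · simp [SS, qb_bot hq0 hq1 le_rfl, qb_zero q (n := -1) (k := -1) (by omega)]
  · intro j hj
    have h1 : SS q 0 0 (1 * j) j = 0 := by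
      by_contra h0; have := SS_ne h0; omega
    have h2 : SS q 0 0 (1 * j + 1) j = 0 := by
      unfold SS
      rw [qb_zero q (n := 0 + 0 - (1 * j + 1) + j) (by omega)]; simp
    rw [h1, h2]; simp

lemma DD_two {q : ℝ} (hq0 : 0 < q) (hq1 : q < 1) (L M : ℕ) :
    DD q 2 L M = if L = 0 then 1 else 0 := by
  have := DD_step hq0 hq1 le_rfl L M
  norm_num at this
  rw [this]
  split_ifs with h
  · subst h
    simp [DD_one_zero hq0 hq1, qb_bot hq0 hq1 (show (0 : ℤ) ≤ M by omega)]
  · refine Finset.sum_eq_zero fun i hi => ?_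
    rw [Finset.mem_range] at hi
    rw [DD_one hq0 hq1 (by omega) (by omega) (by omega), mul_zero]

/-- The fermionic polynomials, defined recursively. -/
def FF (q : ℝ) : ℕ → ℕ → ℕ → ℝ
  | 0, L, _ => if L = 0 then 1 else 0
  | k + 1, L, M => ∑ i ∈ Finset.range (L + 1), q ^ (i ^ 2)
      * qb q (2 * L + M - i) (2 * L) * FF q k (L - i) i

lemma FF_nonneg {q : ℝ} (hq0 : 0 < q) (hq1 : q < 1) (k L M : ℕ) : 0 ≤ FF q k L M := by
  induction k generalizing L M with
  | zero => unfold FF; split_ifs <;> norm_num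
  | succ k ih =>
    unfold FF
    exact Finset.sum_nonneg fun i _ =>
      mul_nonneg (mul_nonneg (pow_pos hq0 _).le (qb_nonneg hq0 hq1 _ _)) (ih _ _)

lemma FF_eq {q : ℝ} (hq0 : 0 < q) (hq1 : q < 1) (k L M : ℕ) :
    FF q k L M = DD q (k + 2) L M := by
  induction k generalizing L M with
  | zero => simp [FF, DD_two hq0 hq1]
  | succ k ih =>
    have := DD_step hq0 hq1 (k := k + 2) (by omega) L M
    rw [show (((k + 1 : ℕ) : ℤ) + 2) = k + 2 + 1 by push_cast; ring, this, FF]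
    refine Finset.sum_congr rfl fun i hi => ?_
    rw [Finset.mem_range] at hi
    rw [ih, Nat.cast_sub (by omega)]
    norm_cast

lemma HH_FF {q : ℝ} (hq0 : 0 < q) (hq1 : q < 1) (k L : ℕ) :
    HH q (k + 3) L = ∑ i ∈ Finset.range (L + 1), q ^ (i ^ 2) * FF q k (L - i) i := by
  rw [show (k : ℤ) + 3 = k + 2 + 1 by ring, HH_eq hq0 hq1 (by omega)]
  refine Finset.sum_congr rfl fun i hi => ?_
  rw [Finset.mem_range] at hi
  rw [FF_eq hq0 hq1, Nat.cast_sub (by omega)]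
  norm_cast
/-! ### Limits -/

lemma summable_q_succ {q : ℝ} (hq0 : 0 < q) (hq1 : q < 1) :
    Summable fun j : ℕ => ‖-q ^ (j + 1)‖ := by
  have := (summable_geometric_of_lt_one hq0.le hq1).mul_left q
  refine this.congr fun j => ?_
  rw [norm_neg, Real.norm_of_nonneg (pow_pos hq0 _).le, pow_succ]
  ring

lemma qPoch_tendsto {q : ℝ} (hq0 : 0 < q) (hq1 : q < 1) :
    Filter.Tendsto (qPoch q) Filter.atTop (nhds (qPochInf q)) := by
  have hm : Multipliable fun j : ℕ => 1 - q ^ (j + 1) := by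
    have := multipliable_one_add_of_summable (summable_q_succ hq0 hq1)
    simpa only [← sub_eq_add_neg] using this
  exact hm.tendsto_prod_tprod_nat

lemma qPoch_anti {q : ℝ} (hq0 : 0 < q) (hq1 : q < 1) : Antitone (qPoch q) := by
  refine antitone_nat_of_succ_le fun n => ?_
  rw [qPoch_succ]
  have h1 := qPoch_pos hq0 hq1 n
  have h2 := pow_pos hq0 (n + 1)
  nlinarith

lemma qPochInf_pos {q : ℝ} (hq0 : 0 < q) (hq1 : q < 1) : 0 < qPochInf q := by
  have hne : qPochInf q ≠ 0 := by
    have := tprod_one_add_ne_zero_of_summable (f := fun j : ℕ => -q ^ (j + 1)) (fun j => by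
      have := pow_lt_one₀ hq0.le hq1 (Nat.succ_ne_zero j)
      simp only [Nat.succ_eq_add_one] at this
      intro h
      linarith) (summable_q_succ hq0 hq1)
    simp only [← sub_eq_add_neg] at this
    exact this
  have h0 : 0 ≤ qPochInf q :=
    ge_of_tendsto' (qPoch_tendsto hq0 hq1) fun n => (qPoch_pos hq0 hq1 n).le
  exact lt_of_le_of_ne h0 hne.symm

lemma qPochInf_le {q : ℝ} (hq0 : 0 < q) (hq1 : q < 1) (n : ℕ) : qPochInf q ≤ qPoch q n :=
  (qPoch_anti hq0 hq1).le_of_tendsto (qPoch_tendsto hq0 hq1) n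

/-- reciprocal of `(q)_s`, zero for negative `s` -/
def rr (q : ℝ) (s : ℤ) : ℝ := if 0 ≤ s then 1 / qPoch q s.toNat else 0

lemma rr_nonneg {q : ℝ} (hq0 : 0 < q) (hq1 : q < 1) (s : ℤ) : 0 ≤ rr q s := by
  unfold rr
  split_ifs
  · exact (one_div_pos.2 (qPoch_pos hq0 hq1 _)).le
  · exact le_rfl

lemma rr_le {q : ℝ} (hq0 : 0 < q) (hq1 : q < 1) (s : ℤ) : rr q s ≤ 1 / qPochInf q := by
  unfold rr
  split_ifs
  · exact one_div_le_one_div_of_le (qPochInf_pos hq0 hq1) (qPochInf_le hq0 hq1 _)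
  · exact (one_div_pos.2 (qPochInf_pos hq0 hq1)).le

lemma qb_le {q : ℝ} (hq0 : 0 < q) (hq1 : q < 1) (n s : ℤ) : qb q n s ≤ rr q s := by
  by_cases h : 0 ≤ s ∧ s ≤ n
  · unfold qb rr
    rw [if_pos h, if_pos h.1, div_le_div_iff₀ (mul_pos (qPoch_pos hq0 hq1 _) (qPoch_pos hq0 hq1 _))
      (qPoch_pos hq0 hq1 _)]
    have := qPoch_anti hq0 hq1 (show (n - s).toNat ≤ n.toNat by omega)
    nlinarith [qPoch_pos hq0 hq1 s.toNat]
  · rw [qb_zero q h]; exact rr_nonneg hq0 hq1 s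

lemma qPoch_tendsto_int {q : ℝ} (hq0 : 0 < q) (hq1 : q < 1) (c : ℤ) :
    Filter.Tendsto (fun n : ℕ => qPoch q ((n : ℤ) + c).toNat) Filter.atTop
      (nhds (qPochInf q)) := by
  refine (qPoch_tendsto hq0 hq1).comp ?_
  refine Filter.tendsto_atTop.2 fun b => ?_
  filter_upwards [Filter.eventually_ge_atTop (b + c.natAbs)] with n hn
  omega

lemma qb_tendsto {q : ℝ} (hq0 : 0 < q) (hq1 : q < 1) (c s : ℤ) :
    Filter.Tendsto (fun n : ℕ => qb q ((n : ℤ) + c) s) Filter.atTop (nhds (rr q s)) := by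
  by_cases hs : 0 ≤ s
  · have hI := (qPochInf_pos hq0 hq1).ne'
    have hS := (qPoch_pos hq0 hq1 s.toNat).ne'
    have h1 := (qPoch_tendsto_int hq0 hq1 c).div
      ((qPoch_tendsto_int hq0 hq1 (c - s)).const_mul (qPoch q s.toNat)) (mul_ne_zero hS hI)
    have e : qPochInf q / (qPoch q s.toNat * qPochInf q) = rr q s := by
      unfold rr
      rw [if_pos hs]
      field_simp
    rw [e] at h1
    refine h1.congr' ?_
    filter_upwards [Filter.eventually_ge_atTop (c.natAbs + s.natAbs)] with n hn
    simp only [Pi.div_apply]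
    unfold qb
    rw [if_pos ⟨hs, by omega⟩, show (n : ℤ) + (c - s) = n + c - s by ring]
  · have : rr q s = 0 := by unfold rr; rw [if_neg hs]
    rw [this]
    refine tendsto_const_nhds.congr fun n => ?_
    rw [qb_zero q (by omega)]

lemma summable_q_sq {q : ℝ} (hq0 : 0 < q) (hq1 : q < 1) :
    Summable fun L : ℕ => q ^ ((L : ℤ) ^ 2) := by
  refine Summable.of_nonneg_of_le (fun L => (zpow_pos hq0 _).le) (fun L => ?_)
    (summable_geometric_of_lt_one hq0.le hq1)
  rw [← zpow_natCast]
  refine zpow_le_zpow_right_of_le_one₀ hq0 hq1.le ?_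
  nlinarith [sq_nonneg ((L : ℤ) - 1), Int.natCast_nonneg L, sq_nonneg (L : ℤ),
    show (L : ℤ) ≤ (L : ℤ) ^ 2 by exact_mod_cast Nat.le_self_pow two_ne_zero L]

lemma durfee {q : ℝ} (hq0 : 0 < q) (hq1 : q < 1) (a : ℤ) :
    HasSum (fun L : ℕ => q ^ ((L : ℤ) ^ 2) / qPoch q (2 * L) * qb q (2 * L) (L + a))
      (q ^ (a ^ 2) / qPochInf q) := by
  have hC := (one_div_pos.2 (qPochInf_pos hq0 hq1)).le
  have eq1 : ∀ L : ℕ, q ^ ((L : ℤ) ^ 2) / qPoch q (2 * L) * qb q (2 * L) (L + a)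
      = q ^ ((L : ℤ) ^ 2) * (rr q (L - a) * rr q (L + a)) := by
    intro L
    by_cases h : 0 ≤ L + a ∧ 0 ≤ L - a
    · unfold qb rr
      rw [if_pos (by omega), if_pos h.1, if_pos h.2, show (2 * (L : ℤ)).toNat = 2 * L by omega,
        show 2 * (L : ℤ) - (L + a) = L - a by ring]
      have h1 := (qPoch_pos hq0 hq1 (2 * L)).ne'
      have h2 := (qPoch_pos hq0 hq1 ((L : ℤ) - a).toNat).ne'
      have h3 := (qPoch_pos hq0 hq1 ((L : ℤ) + a).toNat).ne'
      field_simp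
    · rw [qb_zero q (by omega)]
      unfold rr
      by_cases h1 : 0 ≤ L + a
      · rw [if_neg (show ¬ (0 ≤ (L : ℤ) - a) by omega)]; simp
      · rw [if_neg (show ¬ (0 ≤ (L : ℤ) + a) by omega)]; simp
  have hsum : Summable fun L : ℕ => q ^ ((L : ℤ) ^ 2) * (rr q (L - a) * rr q (L + a)) := by
    refine Summable.of_nonneg_of_le (fun L => mul_nonneg (zpow_pos hq0 _).le
      (mul_nonneg (rr_nonneg hq0 hq1 _) (rr_nonneg hq0 hq1 _))) (fun L => ?_)
      ((summable_q_sq hq0 hq1).mul_right (1 / qPochInf q * (1 / qPochInf q)))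
    exact mul_le_mul_of_nonneg_left (mul_le_mul (rr_le hq0 hq1 _) (rr_le hq0 hq1 _)
      (rr_nonneg hq0 hq1 _) hC) (zpow_pos hq0 _).le
  have lim1 : Filter.Tendsto (fun n : ℕ => ∑' L : ℕ, q ^ ((L : ℤ) ^ 2) *
      (qb q (n + -a) (L - a) * qb q (n + a) (L + a))) Filter.atTop
      (nhds (∑' L : ℕ, q ^ ((L : ℤ) ^ 2) * (rr q (L - a) * rr q (L + a)))) := by
    refine tendsto_tsum_of_dominated_convergence hsum (fun L => ?_) ?_
    · exact ((qb_tendsto hq0 hq1 _ _).mul (qb_tendsto hq0 hq1 _ _)).const_mul _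
    · refine Filter.Eventually.of_forall fun n L => ?_
      rw [Real.norm_of_nonneg (mul_nonneg (zpow_pos hq0 _).le
        (mul_nonneg (qb_nonneg hq0 hq1 _ _) (qb_nonneg hq0 hq1 _ _)))]
      exact mul_le_mul_of_nonneg_left (mul_le_mul (qb_le hq0 hq1 _ _) (qb_le hq0 hq1 _ _)
        (qb_nonneg hq0 hq1 _ _) (rr_nonneg hq0 hq1 _)) (zpow_pos hq0 _).le
  have lim2 : Filter.Tendsto (fun n : ℕ => q ^ (a ^ 2) * qb q (2 * n) (n + a)) Filter.atTop
      (nhds (q ^ (a ^ 2) / qPochInf q)) := by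
    have hI := (qPochInf_pos hq0 hq1).ne'
    have h2 : Filter.Tendsto (fun n : ℕ => qPoch q (2 * n)) Filter.atTop (nhds (qPochInf q)) := by
      refine (qPoch_tendsto hq0 hq1).comp ?_
      refine Filter.tendsto_atTop.2 fun b => ?_
      filter_upwards [Filter.eventually_ge_atTop b] with n hn
      omega
    have h1 := (h2.div
      ((qPoch_tendsto_int hq0 hq1 a).mul (qPoch_tendsto_int hq0 hq1 (-a)))
        (mul_ne_zero hI hI)).const_mul (q ^ (a ^ 2))
    have e : q ^ (a ^ 2) * (qPochInf q / (qPochInf q * qPochInf q)) = q ^ (a ^ 2) / qPochInf q := by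
      field_simp
    rw [e] at h1
    refine h1.congr' ?_
    filter_upwards [Filter.eventually_ge_atTop a.natAbs] with n hn
    simp only [Pi.div_apply]
    unfold qb
    rw [if_pos (by omega), show 2 * (n : ℤ) - (n + a) = n + -a by ring,
      show (2 * (n : ℤ)).toNat = 2 * n by omega]
  have lim3 : Filter.Tendsto (fun n : ℕ => ∑' L : ℕ, q ^ ((L : ℤ) ^ 2) *
      (qb q (n + -a) (L - a) * qb q (n + a) (L + a))) Filter.atTop
      (nhds (q ^ (a ^ 2) / qPochInf q)) := by
    refine lim2.congr' ?_
    filter_upwards [Filter.eventually_ge_atTop a.natAbs] with n hn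
    have := burgeInf hq0 hq1 n 0 a (by omega)
    rw [zero_add] at this
    rw [← this, tsum_eq_sum (s := Finset.range (n + 1))]
    · refine Finset.sum_congr rfl fun i _ => ?_
      rw [SS_kernel]
      ring_nf
    · intro L hL
      rw [Finset.mem_range] at hL
      rw [qb_zero q (n := n + a) (by omega)]; simp
  rw [← tendsto_nhds_unique lim1 lim3]
  simp_rw [eq1]
  exact hsum.hasSum

lemma summable_q_abs {q : ℝ} (hq0 : 0 < q) (hq1 : q < 1) (e : ℤ → ℤ) (he : ∀ j, |j| ≤ e j) :
    Summable fun j : ℤ => q ^ e j := by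
  have h : Summable fun j : ℤ => q ^ |j| := by
    rw [summable_int_iff_summable_nat_and_neg]
    have := summable_geometric_of_lt_one hq0.le hq1
    constructor <;> refine this.congr fun j => ?_ <;> simp
  exact Summable.of_nonneg_of_le (fun j => (zpow_pos hq0 _).le)
    (fun j => zpow_le_zpow_right_of_le_one₀ hq0 hq1.le (he j)) h

lemma exp1_ge {p : ℤ} (hp : 4 ≤ p) (j : ℤ) : |j| ≤ p * (p + 1) * j ^ 2 + j := by
  have h2 : |j| ≤ j ^ 2 := by
    rw [← sq_abs]
    nlinarith [abs_nonneg j, sq_nonneg (|j| - 1), Int.le_self_sq |j|]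
  have h3 := neg_abs_le j
  have h4 : 2 * j ^ 2 ≤ p * (p + 1) * j ^ 2 := mul_le_mul_of_nonneg_right (by nlinarith) (sq_nonneg j)
  linarith

lemma exp2_ge {p : ℤ} (hp : 4 ≤ p) (j : ℤ) : |j| ≤ (p * j + 1) * ((p + 1) * j + 1) := by
  have h2 : |j| ≤ j ^ 2 := by
    rw [← sq_abs]
    nlinarith [abs_nonneg j, sq_nonneg (|j| - 1), Int.le_self_sq |j|]
  have h3 := neg_abs_le j
  have h4 : (p * (p + 1)) * |j| ≤ (p * (p + 1)) * j ^ 2 :=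
    mul_le_mul_of_nonneg_left h2 (by nlinarith)
  have h5 : (2 * p + 1) * (-|j|) ≤ (2 * p + 1) * j := mul_le_mul_of_nonneg_left h3 (by omega)
  have h6 : 0 ≤ (p * (p + 1) - (2 * p + 1) - 1) * |j| := mul_nonneg (by nlinarith) (abs_nonneg j)
  nlinarith

lemma boson {q : ℝ} (hq0 : 0 < q) (hq1 : q < 1) {p : ℤ} (hp : 4 ≤ p) :
    HasSum (fun L : ℕ => q ^ ((L : ℤ) ^ 2) / qPoch q (2 * L) * HH q p L)
      ((∑' j : ℤ, (q ^ (p * (p + 1) * j ^ 2 + j) - q ^ ((p * j + 1) * ((p + 1) * j + 1))))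
        / qPochInf q) := by
  let F : (ℤ → ℤ) → ℤ → ℕ → ℝ := fun e j L =>
    q ^ (j * (p * j + 1)) * (q ^ ((L : ℤ) ^ 2) / qPoch q (2 * L) * qb q (2 * L) (L + e j))
  have hF : ∀ (e : ℤ → ℤ) (j : ℤ), HasSum (F e j)
      (q ^ (j * (p * j + 1) + (e j) ^ 2) / qPochInf q) := by
    intro e j
    have := (durfee hq0 hq1 (e j)).mul_left (q ^ (j * (p * j + 1)))
    rwa [← mul_div_assoc, ← zpow_add₀ hq0.ne'] at this
  have hFs : ∀ (e : ℤ → ℤ), (∀ j, |j| ≤ j * (p * j + 1) + (e j) ^ 2) →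
      Summable (Function.uncurry (F e)) := by
    intro e he
    rw [summable_prod_of_nonneg]
    · refine ⟨fun j => (hF e j).summable, ?_⟩
      have := (summable_q_abs hq0 hq1 _ he).div_const (qPochInf q)
      exact this.congr fun j => (hF e j).tsum_eq.symm
    · rintro ⟨j, L⟩
      exact mul_nonneg (zpow_pos hq0 _).le (mul_nonneg (div_nonneg (zpow_pos hq0 _).le
        (qPoch_pos hq0 hq1 _).le) (qb_nonneg hq0 hq1 _ _))
  have i1 : ∀ j : ℤ, j * (p * j + 1) + (p * j) ^ 2 = p * (p + 1) * j ^ 2 + j := fun j => by ring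
  have i2 : ∀ j : ℤ, j * (p * j + 1) + (p * j + 1) ^ 2 = (p * j + 1) * ((p + 1) * j + 1) :=
    fun j => by ring
  have s1 := hFs (fun j => p * j) fun j => by rw [i1]; exact exp1_ge hp j
  have s2 := hFs (fun j => p * j + 1) fun j => by rw [i2]; exact exp2_ge hp j
  have s := s1.sub s2
  have sw : Summable (Function.uncurry fun (L : ℕ) (j : ℤ) =>
      F (fun j => p * j) j L - F (fun j => p * j + 1) j L) := by
    have := s.prod_symm
    exact this
  have eL : ∀ L : ℕ, q ^ ((L : ℤ) ^ 2) / qPoch q (2 * L) * HH q p L =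
      ∑' j : ℤ, (F (fun j => p * j) j L - F (fun j => p * j + 1) j L) := by
    intro L
    unfold HH
    rw [← tsum_mul_left]
    refine tsum_congr fun j => ?_
    simp only [F]
    ring
  have ej : ∀ j : ℤ, (q ^ (p * (p + 1) * j ^ 2 + j) - q ^ ((p * j + 1) * ((p + 1) * j + 1)))
      / qPochInf q = ∑' L : ℕ, (F (fun j => p * j) j L - F (fun j => p * j + 1) j L) := by
    intro j
    rw [((hF (fun j => p * j) j).sub (hF (fun j => p * j + 1) j)).tsum_eq, i1, i2]
    ring
  rw [← tsum_div_const, tsum_congr ej]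
  simp_rw [eL]
  rw [sw.tsum_comm]
  exact sw.prod.hasSum
/-! ### The fermionic side -/

lemma qBinQ_nat (q : ℝ) (N m : ℕ) : qBinQ q (N : ℚ) m = qb q N m := by
  unfold qBinQ qb
  simp only [Rat.den_natCast, true_and, Nat.cast_le, Rat.num_natCast, Int.toNat_natCast,
    Nat.cast_nonneg]
  split_ifs with h
  · congr 2
    congr 1
    omega
  · rfl

lemma qBinQ_half_even (q : ℝ) (a c A b : ℕ) (h : a + c = 2 * A) :
    qBinQ q (((a : ℚ) + c) / 2) b = qb q A b := by
  rw [← qBinQ_nat]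
  congr 1
  have : (a : ℚ) + c = 2 * A := by exact_mod_cast h
  rw [this]; ring

lemma qBinQ_half_odd (q : ℝ) (a c b : ℕ) (h : (a + c) % 2 = 1) :
    qBinQ q (((a : ℚ) + c) / 2) b = 0 := by
  unfold qBinQ
  rw [if_neg]
  rintro ⟨h1, -⟩
  have h2 := (Rat.den_eq_one_iff _).1 h1
  have h3 : ((2 * (((a : ℚ) + c) / 2).num : ℤ) : ℚ) = ((a + c : ℕ) : ℤ) := by
    push_cast
    rw [h2]; ring
  have h4 := Int.cast_injective h3
  omega

lemma qBinQ_nonneg {q : ℝ} (hq0 : 0 < q) (hq1 : q < 1) (N : ℚ) (m : ℕ) : 0 ≤ qBinQ q N m := by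
  unfold qBinQ
  split_ifs
  · exact div_nonneg (qPoch_pos hq0 hq1 _).le
      (mul_pos (qPoch_pos hq0 hq1 _) (qPoch_pos hq0 hq1 _)).le
  · exact le_rfl

/-- Weight of a chain of occupation numbers. -/
def CC (q : ℝ) (n : ℕ) (z : ℕ → ℕ) : ℝ :=
  if z (n + 1) % 2 = 0 then
    q ^ ((∑ i ∈ Finset.range (n + 1), ((z (i + 1) : ℝ) - z (i + 2)) ^ 2) / 4)
      * ∏ i ∈ Finset.range (n + 1), qBinQ q (((z i : ℚ) + z (i + 2)) / 2) (z (i + 1))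
  else 0

lemma CC_nonneg {q : ℝ} (hq0 : 0 < q) (hq1 : q < 1) (n : ℕ) (z : ℕ → ℕ) : 0 ≤ CC q n z := by
  unfold CC
  split_ifs
  · exact mul_nonneg (Real.rpow_pos_of_pos hq0 _).le
      (Finset.prod_nonneg fun i _ => qBinQ_nonneg hq0 hq1 _ _)
  · exact le_rfl

/-- One link of the chain. -/
def link (q : ℝ) (a b c : ℕ) : ℝ :=
  q ^ (((b : ℝ) - c) ^ 2 / 4) * qBinQ q (((a : ℚ) + c) / 2) b

lemma link_nonneg {q : ℝ} (hq0 : 0 < q) (hq1 : q < 1) (a b c : ℕ) : 0 ≤ link q a b c :=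
  mul_nonneg (Real.rpow_pos_of_pos hq0 _).le (qBinQ_nonneg hq0 hq1 _ _)

lemma CC_succ {q : ℝ} (hq0 : 0 < q) (n : ℕ) (z : ℕ → ℕ) :
    CC q (n + 1) z = link q (z 0) (z 1) (z 2) * CC q n (fun i => z (i + 1)) := by
  unfold CC link
  rw [Finset.sum_range_succ' _ (n + 1), Finset.prod_range_succ' _ (n + 1), add_div,
    Real.rpow_add hq0]
  split_ifs
  · simp only [zero_add]
    ring
  · simp

/-- The sequence `a, b, t_0, …, t_{n-1}, 0, 0, …`. -/
def zseq (n : ℕ) (a b : ℕ) (t : Fin n → ℕ) : ℕ → ℕ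
  | 0 => a
  | 1 => b
  | i + 2 => if h : i < n then t ⟨i, h⟩ else 0

/-- Tail sums. -/
def TT (q : ℝ) (n a b : ℕ) : ENNReal := ∑' t : Fin n → ℕ, ENNReal.ofReal (CC q n (zseq n a b t))

lemma tsum_cons (n : ℕ) (f : (Fin (n + 1) → ℕ) → ENNReal) :
    ∑' m, f m = ∑' c : ℕ, ∑' t : Fin n → ℕ, f (Fin.cons c t) := by
  rw [← (Fin.consEquiv (fun _ : Fin (n + 1) => ℕ)).tsum_eq, ENNReal.tsum_prod']
  rfl

lemma zseq_cons (n a b c : ℕ) (t : Fin n → ℕ) :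
    (fun i => zseq (n + 1) a b (Fin.cons c t) (i + 1)) = zseq n b c t := by
  funext i
  match i with
  | 0 => rfl
  | 1 => simp [zseq]
  | i + 2 =>
    simp only [zseq]
    by_cases h : i < n
    · rw [dif_pos h, dif_pos (by omega)]
      exact Fin.cons_succ (α := fun _ => ℕ) c t ⟨i, h⟩
    · rw [dif_neg h, dif_neg (by omega)]

lemma TT_zero (q : ℝ) (a b : ℕ) :
    TT q 0 a b = ENNReal.ofReal (if b % 2 = 0 then link q a b 0 else 0) := by
  unfold TT
  rw [tsum_eq_single (fun i => i.elim0) (fun t ht => absurd (Subsingleton.elim _ _) ht)]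
  simp [CC, zseq, link]

lemma TT_succ {q : ℝ} (hq0 : 0 < q) (hq1 : q < 1) (n a b : ℕ) :
    TT q (n + 1) a b = ∑' c : ℕ, ENNReal.ofReal (link q a b c) * TT q n b c := by
  unfold TT
  rw [tsum_cons]
  refine tsum_congr fun c => ?_
  rw [← ENNReal.tsum_mul_left]
  refine tsum_congr fun t => ?_
  rw [CC_succ hq0, zseq_cons, ENNReal.ofReal_mul]
  · simp [zseq]
  · exact link_nonneg hq0 hq1 _ _ _

lemma TT_odd {q : ℝ} (hq0 : 0 < q) (hq1 : q < 1) (n a b : ℕ) (h : a % 2 = 1 ∨ b % 2 = 1) :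
    TT q n a b = 0 := by
  induction n generalizing a b with
  | zero =>
    rw [TT_zero]
    split_ifs with hb
    · unfold link
      rw [qBinQ_half_odd q a 0 b (by omega)]; simp
    · simp
  | succ n ih =>
    rw [TT_succ hq0 hq1, ENNReal.tsum_eq_zero]
    intro c
    by_cases hbc : b % 2 = 1 ∨ c % 2 = 1
    · rw [ih _ _ hbc, mul_zero]
    · unfold link
      rw [qBinQ_half_odd q a c b (by omega)]; simp

lemma link_even {q : ℝ} (A B C : ℕ) :
    link q (2 * A) (2 * B) (2 * C) = q ^ (((B : ℤ) - C) ^ 2) * qb q (A + C) (2 * B) := by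
  unfold link
  rw [qBinQ_half_even q _ _ (A + C) _ (by ring), ← Real.rpow_intCast]
  push_cast
  congr 2
  ring

lemma TT_even {q : ℝ} (hq0 : 0 < q) (hq1 : q < 1) (n A B : ℕ) :
    TT q n (2 * A) (2 * B) =
      if B ≤ A then ENNReal.ofReal (FF q (n + 1) B (A - B)) else 0 := by
  induction n generalizing A B with
  | zero =>
    rw [TT_zero, if_pos (by omega)]
    have hl := link_even (q := q) A B 0
    rw [mul_zero] at hl
    rw [hl]
    split_ifs with h
    · congr 1
      unfold FF
      rw [Finset.sum_eq_single B]
      · rw [FF, if_pos (by omega), mul_one, Nat.cast_sub h]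
        rw [show (2 * (B : ℤ) + ((A : ℤ) - B) - B) = A by ring, Nat.cast_zero, sub_zero, add_zero,
          ← zpow_natCast]
        push_cast
        rfl
      · intro i hi hne
        rw [Finset.mem_range] at hi
        rw [FF, if_neg (by omega), mul_zero]
      · intro h; exact absurd (Finset.mem_range.2 (by omega)) h
    · rw [qb_zero q (by push_cast; omega)]; simp
  | succ n ih =>
    rw [TT_succ hq0 hq1]
    split_ifs with h
    · rw [tsum_eq_sum (s := (Finset.range (B + 1)).image fun i => 2 * (B - i)), Finset.sum_image]
      · rw [FF, ENNReal.ofReal_sum_of_nonneg]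
        · refine Finset.sum_congr rfl fun i hi => ?_
          rw [Finset.mem_range] at hi
          rw [ih, if_pos (by omega), link_even, ← ENNReal.ofReal_mul]
          · congr 2
            · congr 1
              · rw [← zpow_natCast]
                congr 1
                rw [Nat.cast_sub (by omega)]; push_cast; ring
              · congr 1
                rw [Nat.cast_sub (by omega), Nat.cast_sub (by omega)]; ring
            · congr 1; omega
          · exact mul_nonneg (zpow_pos hq0 _).le (qb_nonneg hq0 hq1 _ _)
        · intro i _
          exact mul_nonneg (mul_nonneg (pow_pos hq0 _).le (qb_nonneg hq0 hq1 _ _))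
            (FF_nonneg hq0 hq1 _ _ _)
      · intro i hi j hj hij
        simp only [Finset.coe_range, Set.mem_Iio] at hi hj
        simp only at hij
        omega
      · intro c hc
        rcases Nat.mod_two_eq_zero_or_one c with h0 | h1
        · obtain ⟨C, rfl⟩ : ∃ C, c = 2 * C := ⟨c / 2, by omega⟩
          rw [ih, if_neg, mul_zero]
          intro hC
          apply hc
          rw [Finset.mem_image]
          exact ⟨B - C, by rw [Finset.mem_range]; omega, by omega⟩
        · rw [TT_odd hq0 hq1 _ _ _ (Or.inr h1), mul_zero]
    · rw [ENNReal.tsum_eq_zero]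
      intro c
      rcases Nat.mod_two_eq_zero_or_one c with h0 | h1
      · obtain ⟨C, rfl⟩ : ∃ C, c = 2 * C := ⟨c / 2, by omega⟩
        rw [ih]
        split_ifs with hC
        · rw [link_even, qb_zero q (by omega)]; simp
        · simp
      · rw [TT_odd hq0 hq1 _ _ _ (Or.inr h1), mul_zero]

/-- Prefactor depending on `m₀, m₁, m₂`. -/
def gg (q : ℝ) (a b c : ℕ) : ℝ :=
  q ^ ((a : ℝ) ^ 2 / 2 + ((b : ℝ) ^ 2 + ((b : ℝ) - c) ^ 2) / 4) * (1 / qPoch q a)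
    * qBinQ q ((c : ℚ) / 2) b

lemma gg_nonneg {q : ℝ} (hq0 : 0 < q) (hq1 : q < 1) (a b c : ℕ) : 0 ≤ gg q a b c :=
  mul_nonneg (mul_nonneg (Real.rpow_pos_of_pos hq0 _).le
    (one_div_pos.2 (qPoch_pos hq0 hq1 _)).le) (qBinQ_nonneg hq0 hq1 _ _)

lemma vandInf {q : ℝ} (hq0 : 0 < q) (hq1 : q < 1) (B a : ℕ) :
    ∑ s ∈ Finset.range (a + 1), q ^ (((B : ℤ) - s) * (a - s)) * qb q B s * rr q (a - s)
      = rr q a := by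
  have l1 : Filter.Tendsto (fun n : ℕ => ∑ s ∈ Finset.range (a + 1),
      q ^ (((B : ℤ) - s) * (a - s)) * qb q B s * qb q (n + 0) (a - s)) Filter.atTop
      (nhds (∑ s ∈ Finset.range (a + 1),
        q ^ (((B : ℤ) - s) * (a - s)) * qb q B s * rr q (a - s))) :=
    tendsto_finsetSum _ fun s _ => (qb_tendsto hq0 hq1 0 _).const_mul _
  refine tendsto_nhds_unique l1 ((qb_tendsto hq0 hq1 B a).congr fun n => ?_)
  have := vand hq0 hq1 B (n := n + 0) (by omega) a
  rw [tsum_int_range a] at this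
  · rw [this]; congr 1; ring
  · intro s hs
    have a1 := qb_ne (left_ne_zero_of_mul (right_ne_zero_of_mul (by rwa [mul_assoc] at hs)))
    have a2 := qb_ne (right_ne_zero_of_mul hs)
    omega

lemma gg_sum {q : ℝ} (hq0 : 0 < q) (hq1 : q < 1) (B a : ℕ) :
    ∑ x ∈ Finset.HasAntidiagonal.antidiagonal a, gg q x.1 x.2 (2 * B)
      = q ^ (((a : ℝ) ^ 2 + ((a : ℝ) - 2 * B) ^ 2) / 4) * (1 / qPoch q a) := by
  have h := vandInf hq0 hq1 B a
  rw [← Finset.Nat.sum_antidiagonal_swap]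
  simp only [Prod.fst_swap, Prod.snd_swap]
  rw [Finset.Nat.sum_antidiagonal_eq_sum_range_succ (fun i j => gg q j i (2 * B))]
  have e : (1 / qPoch q a) = rr q a := by simp [rr]
  rw [e, ← h, Finset.mul_sum]
  refine Finset.sum_congr rfl fun s hs => ?_
  rw [Finset.mem_range] at hs
  have e2 : rr q ((a : ℤ) - s) = 1 / qPoch q (a - s) := by
    rw [← Nat.cast_sub (by omega)]; simp [rr]
  have e3 : qBinQ q (((2 * B : ℕ) : ℚ) / 2) s = qb q B s := by
    have := qBinQ_half_even q (2 * B) 0 B s (by ring)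
    simpa using this
  unfold gg
  rw [e2, e3, ← Real.rpow_intCast, ← mul_assoc, ← mul_assoc, ← Real.rpow_add hq0, mul_right_comm]
  congr 3
  push_cast [Nat.cast_sub (show s ≤ a by omega)]
  ring

lemma fermion_sum {q : ℝ} (hq0 : 0 < q) (hq1 : q < 1) (n : ℕ) :
    ∑' (a : ℕ) (b : ℕ) (c : ℕ), ENNReal.ofReal (gg q a b c) * TT q n (a + b) c
      = ∑' A : ℕ, ENNReal.ofReal (q ^ ((A : ℤ) ^ 2) / qPoch q (2 * A) * HH q (n + 4) A) := by
  have evens : ∀ f : ℕ → ENNReal, (∀ c, c % 2 = 1 → f c = 0) → ∑' c, f c = ∑' C, f (2 * C) := by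
    intro f hf
    have hinj : Function.Injective fun C : ℕ => 2 * C := fun x y h => by simpa using h
    refine (hinj.tsum_eq ?_).symm
    intro c hc
    rcases Nat.mod_two_eq_zero_or_one c with h0 | h1
    · exact ⟨c / 2, by simp only; omega⟩
    · exact absurd (hf c h1) hc
  have step1 : ∑' (a : ℕ) (b : ℕ) (c : ℕ), ENNReal.ofReal (gg q a b c) * TT q n (a + b) c
      = ∑' c : ℕ, ∑' s : ℕ, (∑ x ∈ Finset.HasAntidiagonal.antidiagonal s, ENNReal.ofReal (gg q x.1 x.2 c))
          * TT q n s c := by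
    rw [← ENNReal.tsum_prod' (f := fun x : ℕ × ℕ =>
      ∑' c : ℕ, ENNReal.ofReal (gg q x.1 x.2 c) * TT q n (x.1 + x.2) c), ENNReal.tsum_comm]
    refine tsum_congr fun c => ?_
    rw [← Finset.HasAntidiagonal.sigmaAntidiagonalEquivProd.tsum_eq, ENNReal.tsum_sigma']
    refine tsum_congr fun s => ?_
    rw [tsum_fintype, Finset.sum_mul, ← Finset.sum_coe_sort (Finset.HasAntidiagonal.antidiagonal s)]
    refine Finset.sum_congr rfl fun x _ => ?_
    simp only [Finset.HasAntidiagonal.sigmaAntidiagonalEquivProd_apply]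
    rw [Finset.HasAntidiagonal.mem_antidiagonal.1 x.2]
  rw [step1, evens _ fun c hc => ?_]
  · have step2 : ∀ B : ℕ, ∑' s : ℕ, (∑ x ∈ Finset.HasAntidiagonal.antidiagonal s,
        ENNReal.ofReal (gg q x.1 x.2 (2 * B))) * TT q n s (2 * B) =
        ∑' A : ℕ, ENNReal.ofReal (q ^ ((A : ℤ) ^ 2 + ((A : ℤ) - B) ^ 2) * (1 / qPoch q (2 * A))) *
          (if B ≤ A then ENNReal.ofReal (FF q (n + 1) B (A - B)) else 0) := by
      intro B
      rw [evens _ fun s hs => by rw [TT_odd hq0 hq1 _ _ _ (Or.inl hs), mul_zero]]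
      refine tsum_congr fun A => ?_
      rw [TT_even hq0 hq1, ← ENNReal.ofReal_sum_of_nonneg fun x _ => gg_nonneg hq0 hq1 _ _ _,
        gg_sum hq0 hq1, ← Real.rpow_intCast]
      congr 4
      push_cast
      ring
    rw [tsum_congr step2, ENNReal.tsum_comm]
    refine tsum_congr fun A => ?_
    rw [show ((n : ℤ) + 4) = ((n + 1 : ℕ) : ℤ) + 3 by push_cast; ring, HH_FF hq0 hq1,
      tsum_eq_sum (s := Finset.range (A + 1)), Finset.mul_sum, ENNReal.ofReal_sum_of_nonneg,
      ← Finset.sum_range_reflect]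
    · refine Finset.sum_congr rfl fun i hi => ?_
      rw [Finset.mem_range] at hi
      rw [show A + 1 - 1 - i = A - i by omega, if_pos (by omega), ← ENNReal.ofReal_mul,
        show A - (A - i) = i by omega]
      · congr 1
        rw [Nat.cast_sub (by omega), show (A : ℤ) - (A - i) = i by ring, zpow_add₀ hq0.ne',
          ← zpow_natCast q (i ^ 2)]
        push_cast
        ring
      · exact mul_nonneg (zpow_pos hq0 _).le (one_div_pos.2 (qPoch_pos hq0 hq1 _)).le
    · intro i _
      exact mul_nonneg (div_nonneg (zpow_pos hq0 _).le (qPoch_pos hq0 hq1 _).le)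
        (mul_nonneg (pow_pos hq0 _).le (FF_nonneg hq0 hq1 _ _ _))
    · intro B hB
      rw [Finset.mem_range] at hB
      rw [if_neg (by omega), mul_zero]
  · rw [ENNReal.tsum_eq_zero]
    intro s
    rw [TT_odd hq0 hq1 _ _ _ (Or.inr hc), mul_zero]

/-! ### Rewriting the summand -/

/-- The matrix `ItM` with natural number indices. -/
def INn (i j : ℕ) : ℚ :=
  if i = 0 then (if j = 2 then -1 else 0)
  else if j = 0 then (if i = 2 then 1 else 0)
  else if i = j + 1 ∨ j = i + 1 then 1 else 0

/-- Row sums. -/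
def RR (x : ℕ → ℚ) : ℕ → ℚ
  | 0 => -x 2
  | 1 => x 2
  | 2 => x 0 + x 1 + x 3
  | i + 3 => x (i + 2) + x (i + 4)

lemma sum_ind (x : ℕ → ℚ) (N k : ℕ) (h : k < N ∨ x k = 0) :
    ∑ j ∈ Finset.range N, (if j = k then x j else 0) = x k := by
  rw [Finset.sum_ite_eq']
  split_ifs with h1
  · rfl
  · rw [Finset.mem_range] at h1
    rcases h with h | h
    · exact absurd h h1
    · exact h.symm

lemma rowsum (x : ℕ → ℚ) (n i : ℕ) (hi : i < n + 3) (hx : x (n + 3) = 0) :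
    ∑ j ∈ Finset.range (n + 3), INn i j * x j = RR x i := by
  match i with
  | 0 =>
    rw [RR, ← sum_ind x (n + 3) 2 (Or.inl (by omega)), ← Finset.sum_neg_distrib]
    refine Finset.sum_congr rfl fun j _ => ?_
    unfold INn
    split_ifs <;> simp_all
  | 1 =>
    rw [RR, ← sum_ind x (n + 3) 2 (Or.inl (by omega))]
    refine Finset.sum_congr rfl fun j _ => ?_
    unfold INn
    split_ifs <;> first | contradiction | omega | simp
  | 2 =>
    have h3 : 3 < n + 3 ∨ x 3 = 0 := by
      rcases Nat.eq_zero_or_pos n with h | h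
      · subst h; exact Or.inr hx
      · exact Or.inl (by omega)
    rw [RR, ← sum_ind x (n + 3) 0 (Or.inl (by omega)), ← sum_ind x (n + 3) 1 (Or.inl (by omega)),
      ← sum_ind x (n + 3) 3 h3, ← Finset.sum_add_distrib, ← Finset.sum_add_distrib]
    refine Finset.sum_congr rfl fun j _ => ?_
    unfold INn
    split_ifs <;> first | contradiction | omega | simp
  | i + 3 =>
    have h4 : i + 4 < n + 3 ∨ x (i + 4) = 0 := by
      rcases Nat.lt_or_ge (i + 4) (n + 3) with h | h
      · exact Or.inl h
      · right
        rw [show i + 4 = n + 3 by omega]; exact hx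
    rw [RR, ← sum_ind x (n + 3) (i + 2) (Or.inl (by omega)), ← sum_ind x (n + 3) (i + 4) h4,
      ← Finset.sum_add_distrib]
    refine Finset.sum_congr rfl fun j _ => ?_
    unfold INn
    split_ifs <;> first | contradiction | omega | simp

lemma telescope (x : ℕ → ℚ) (n : ℕ) :
    ∑ k ∈ Finset.range (n + 1), (x (k + 2) - x (k + 3)) ^ 2
      = x 2 ^ 2 - x 2 * x 3
        + ∑ k ∈ Finset.range n, x (k + 3) * (2 * x (k + 3) - x (k + 2) - x (k + 4))
        + x (n + 3) ^ 2 - x (n + 2) * x (n + 3) := by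
  induction n with
  | zero => simp; ring
  | succ n ih =>
    rw [Finset.sum_range_succ, ih, Finset.sum_range_succ]
    ring

lemma quad (x : ℕ → ℚ) (n : ℕ) (hx : x (n + 3) = 0) :
    ∑ i ∈ Finset.range (n + 3), x i * (2 * x i - RR x i)
      = 2 * x 0 ^ 2 + (x 1 ^ 2 + (x 1 - x 2) ^ 2)
        + ∑ k ∈ Finset.range (n + 1), (x (k + 2) - x (k + 3)) ^ 2 := by
  rw [telescope, hx, Finset.sum_range_succ', Finset.sum_range_succ', Finset.sum_range_succ']
  have : ∀ k, x (k + 1 + 1 + 1) * (2 * x (k + 1 + 1 + 1) - RR x (k + 1 + 1 + 1))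
      = x (k + 3) * (2 * x (k + 3) - x (k + 2) - x (k + 4)) := by
    intro k
    show x (k + 3) * (2 * x (k + 3) - (x (k + 2) + x (k + 4))) = _
    ring
  rw [Finset.sum_congr rfl fun k _ => this k]
  simp only [RR, zero_add]
  norm_num
  ring

/-- Extension of a finite vector by zero. -/
def xext (N : ℕ) (m : Fin N → ℕ) (i : ℕ) : ℕ := if h : i < N then m ⟨i, h⟩ else 0

lemma xext_val (N : ℕ) (m : Fin N → ℕ) (i : Fin N) : xext N m i = m i := by
  simp [xext]

/-- Chain associated with a sequence. -/
def chain (x : ℕ → ℕ) : ℕ → ℕ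
  | 0 => x 0 + x 1
  | i + 1 => x (i + 2)

lemma row_eq (n : ℕ) (m : Fin (n + 3) → ℕ) (i : Fin (n + 3)) :
    ∑ j, ItM (n + 4) i j * (m j : ℚ) = RR (fun k => (xext (n + 3) m k : ℚ)) i := by
  rw [← rowsum _ n i i.2 (by simp [xext]), Finset.sum_range]
  refine Finset.sum_congr rfl fun j _ => ?_
  rw [xext_val]
  rfl

lemma Phi_eq (n : ℕ) (m : Fin (n + 3) → ℕ) (x : ℕ → ℕ) (hx : x = xext (n + 3) m) :
    PhiQ (n + 4) 0 m = ((x 0 : ℚ) ^ 2 / 2 + ((x 1 : ℚ) ^ 2 + ((x 1 : ℚ) - x 2) ^ 2) / 4)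
      + (∑ i ∈ Finset.range (n + 1),
        ((chain x (i + 1) : ℚ) - chain x (i + 2)) ^ 2) / 4 := by
  have h0 : ((x (n + 3) : ℕ) : ℚ) = 0 := by simp [hx, xext]
  have h := quad (fun k => (x k : ℚ)) n h0
  have h2 : ∑ i : Fin (n + 3), ∑ j : Fin (n + 3), (m i : ℚ) * CtM (n + 4) i j * (m j : ℚ)
      = ∑ i ∈ Finset.range (n + 3), (x i : ℚ) * (2 * x i - RR (fun k => (x k : ℚ)) i) := by
    rw [Finset.sum_range]
    refine Finset.sum_congr rfl fun i _ => ?_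
    have hr := row_eq n m i
    rw [← hx] at hr
    rw [← hr, show x i = m i by rw [hx, xext_val], mul_sub, Finset.mul_sum]
    have h3 : ∀ j : Fin (n + 3), (m i : ℚ) * CtM (n + 4) i j * (m j : ℚ)
        = (if i = j then (m i : ℚ) * (2 * m j) else 0) - (m i : ℚ) * (ItM (n + 4) i j * m j) := by
      intro j
      unfold CtM
      by_cases hij : i = j
      · rw [if_pos hij, if_pos hij]; ring
      · rw [if_neg hij, if_neg hij]; ring
    rw [Finset.sum_congr rfl fun j _ => h3 j, Finset.sum_sub_distrib, Finset.sum_ite_eq]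
    simp
  unfold PhiQ
  have h4 : (∑ j : Fin (n + 4 - 1), (0 : Fin (n + 4 - 1) → ℚ) j * (m j : ℚ)) = 0 := by simp
  rw [h4]
  have h5 := h2.trans h
  simp only [chain]
  have h6 : ∀ a b c d : ℚ, a = b → b = c * 4 → d = 0 → a / 4 - d / 2 = c := by
    intro a b c d e1 e2 e3
    rw [e1, e2, e3]; ring
  exact h6 _ _ _ _ h5 (by ring) rfl

lemma prod_eq (q : ℝ) (n : ℕ) (m : Fin (n + 3) → ℕ) (x : ℕ → ℕ) (hx : x = xext (n + 3) m) :
    ∏ i ∈ Finset.univ.filter (fun i : Fin (n + 3) => i.val ≠ 0),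
        qBinQ q ((∑ j, ItM (n + 4) i j * (m j : ℚ)) / 2) (m i)
      = qBinQ q ((x 2 : ℚ) / 2) (x 1) * ∏ i ∈ Finset.range (n + 1),
          qBinQ q (((chain x i : ℚ) + chain x (i + 2)) / 2) (chain x (i + 1)) := by
  have h1 : ∏ i ∈ Finset.univ.filter (fun i : Fin (n + 3) => i.val ≠ 0),
        qBinQ q ((∑ j, ItM (n + 4) i j * (m j : ℚ)) / 2) (m i)
      = ∏ i ∈ Finset.range (n + 3), if i ≠ 0 then
          qBinQ q (RR (fun k => (x k : ℚ)) i / 2) (x i) else 1 := by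
    rw [Finset.prod_filter, Finset.prod_range]
    refine Finset.prod_congr rfl fun i _ => ?_
    have hr := row_eq n m i
    rw [← hx] at hr
    rw [hr, show x i = m i by rw [hx, xext_val]]
  rw [h1, Finset.prod_range_succ', Finset.prod_range_succ', mul_comm]
  rw [if_neg (by simp), one_mul, mul_comm, if_pos (by omega)]
  congr 1
  refine Finset.prod_congr rfl fun i _ => ?_
  rw [if_pos (by omega)]
  match i with
  | 0 => simp [RR, chain]
  | i + 1 => rfl

lemma term_eq {q : ℝ} (hq0 : 0 < q) (n : ℕ) (m : Fin (n + 3) → ℕ) :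
    (if mlast (n + 4) m % 2 = 0 then
        q ^ ((PhiQ (n + 4) 0 m : ℝ)) * (1 / qPoch q (m ⟨0, by omega⟩))
          * ∏ i ∈ Finset.univ.filter (fun i : Fin (n + 3) => i.val ≠ 0),
              qBinQ q ((∑ j, ItM (n + 4) i j * (m j : ℚ)) / 2) (m i)
      else 0)
    = gg q (m 0) (m 1) (m 2) * CC q n (chain (xext (n + 3) m)) := by
  rw [prod_eq q n m _ rfl, Phi_eq n m _ rfl]
  have hl : mlast (n + 4) m = chain (xext (n + 3) m) (n + 1) := by
    simp [mlast, chain, xext]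
  have e0 : xext (n + 3) m 0 = m 0 := xext_val _ m 0
  have e1 : xext (n + 3) m 1 = m 1 := xext_val _ m 1
  have e2 : xext (n + 3) m 2 = m 2 := xext_val _ m 2
  rw [hl, e0, e1, e2]
  unfold CC gg
  split_ifs
  · push_cast
    rw [Real.rpow_add hq0]
    have : m ⟨0, by omega⟩ = m 0 := rfl
    rw [this]
    ring
  · simp

lemma chain_cons (n a b c : ℕ) (t : Fin n → ℕ) :
    chain (xext (n + 3) (Fin.cons a (Fin.cons b (Fin.cons c t) : Fin (n + 2) → ℕ)))
      = zseq n (a + b) c t := by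
  funext i
  match i with
  | 0 => simp [chain, xext, zseq]
  | 1 => simp [chain, xext, zseq]; rfl
  | i + 2 =>
    simp only [chain, xext, zseq]
    by_cases h : i < n
    · rw [dif_pos h, dif_pos (by omega)]; rfl
    · rw [dif_neg h, dif_neg (by omega)]

lemma total {q : ℝ} (hq0 : 0 < q) (hq1 : q < 1) (n : ℕ) :
    ∑' m : Fin (n + 3) → ℕ,
      ENNReal.ofReal (gg q (m 0) (m 1) (m 2) * CC q n (chain (xext (n + 3) m)))
      = ENNReal.ofReal ((∑' j : ℤ, (q ^ (((n : ℤ) + 4) * (((n : ℤ) + 4) + 1) * j ^ 2 + j)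
          - q ^ ((((n : ℤ) + 4) * j + 1) * ((((n : ℤ) + 4) + 1) * j + 1)))) / qPochInf q) := by
  have hb := boson hq0 hq1 (p := (n : ℤ) + 4) (by omega)
  have hnn : ∀ L : ℕ, 0 ≤ q ^ ((L : ℤ) ^ 2) / qPoch q (2 * L) * HH q ((n : ℤ) + 4) L := by
    intro L
    refine mul_nonneg (div_nonneg (zpow_pos hq0 _).le (qPoch_pos hq0 hq1 _).le) ?_
    rw [show ((n : ℤ) + 4) = ((n + 1 : ℕ) : ℤ) + 3 by push_cast; ring, HH_FF hq0 hq1]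
    exact Finset.sum_nonneg fun i _ => mul_nonneg (pow_pos hq0 _).le (FF_nonneg hq0 hq1 _ _ _)
  rw [← hb.tsum_eq, ENNReal.ofReal_tsum_of_nonneg hnn hb.summable, ← fermion_sum hq0 hq1, tsum_cons]
  refine tsum_congr fun a => ?_
  rw [tsum_cons]
  refine tsum_congr fun b => ?_
  rw [tsum_cons]
  refine tsum_congr fun c => ?_
  rw [TT, ← ENNReal.tsum_mul_left]
  refine tsum_congr fun t => ?_
  rw [chain_cons, ENNReal.ofReal_mul (gg_nonneg hq0 hq1 _ _ _)]
  rfl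

/-- Fermionic representation of the vacuum Virasoro character `χ^{p,p+1}_{1,1}(q)`:
for `p ≥ 4` and `0 < q < 1`,
`Σ_m q^{(m·C̃m)/4} (1/(q)_{m_0}) ∏_{j=1}^{p-2} [(½Ĩm)_j choose m_j]_q
  = (1/(q)_∞) Σ_{j∈ℤ} (q^{p(p+1)j²+j} - q^{(pj+1)((p+1)j+1)})`,
the left sum over all `m ∈ ℤ^{p-1}_{≥0}` with `m_{p-2}` even; both sides
converge absolutely. -/
theorem fermionic_vacuum_character (p : ℕ) (hp : 4 ≤ p) (q : ℝ) (hq0 : 0 < q) (hq1 : q < 1) :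
    Summable (fun m : Fin (p - 1) → ℕ =>
      if mlast p m % 2 = 0 then
        q ^ ((PhiQ p 0 m : ℝ)) * (1 / qPoch q (m ⟨0, by omega⟩))
          * ∏ i ∈ Finset.univ.filter (fun i : Fin (p - 1) => i.val ≠ 0),
              qBinQ q ((∑ j, ItM p i j * (m j : ℚ)) / 2) (m i)
      else 0) ∧
    Summable (fun j : ℤ =>
      q ^ ((p : ℤ) * ((p : ℤ) + 1) * j ^ 2 + j)
        - q ^ (((p : ℤ) * j + 1) * (((p : ℤ) + 1) * j + 1))) ∧
    (∑' m : Fin (p - 1) → ℕ,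
      if mlast p m % 2 = 0 then
        q ^ ((PhiQ p 0 m : ℝ)) * (1 / qPoch q (m ⟨0, by omega⟩))
          * ∏ i ∈ Finset.univ.filter (fun i : Fin (p - 1) => i.val ≠ 0),
              qBinQ q ((∑ j, ItM p i j * (m j : ℚ)) / 2) (m i)
      else 0)
      = (∑' j : ℤ,
          (q ^ ((p : ℤ) * ((p : ℤ) + 1) * j ^ 2 + j)
            - q ^ (((p : ℤ) * j + 1) * (((p : ℤ) + 1) * j + 1)))) / qPochInf q := by
  obtain ⟨n, rfl⟩ : ∃ n, p = n + 4 := ⟨p - 4, by omega⟩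
  have hp4 : (4 : ℤ) ≤ ((n + 4 : ℕ) : ℤ) := by omega
  have hnn : ∀ m : Fin (n + 3) → ℕ,
      0 ≤ gg q (m 0) (m 1) (m 2) * CC q n (chain (xext (n + 3) m)) := fun m =>
    mul_nonneg (gg_nonneg hq0 hq1 _ _ _) (CC_nonneg hq0 hq1 _ _)
  have ht := total hq0 hq1 n
  have hs : Summable fun m : Fin (n + 3) → ℕ =>
      gg q (m 0) (m 1) (m 2) * CC q n (chain (xext (n + 3) m)) := by
    have h1 := ENNReal.summable_toReal (ht.trans_ne ENNReal.ofReal_ne_top)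
    refine h1.congr fun m => ?_
    rw [ENNReal.toReal_ofReal (hnn m)]
  have hb := boson hq0 hq1 (p := (n : ℤ) + 4) (by omega)
  have hR : 0 ≤ (∑' j : ℤ, (q ^ (((n : ℤ) + 4) * (((n : ℤ) + 4) + 1) * j ^ 2 + j)
          - q ^ ((((n : ℤ) + 4) * j + 1) * ((((n : ℤ) + 4) + 1) * j + 1)))) / qPochInf q := by
    rw [← hb.tsum_eq]
    refine tsum_nonneg fun L => ?_
    refine mul_nonneg (div_nonneg (zpow_pos hq0 _).le (qPoch_pos hq0 hq1 _).le) ?_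
    rw [show ((n : ℤ) + 4) = ((n + 1 : ℕ) : ℤ) + 3 by push_cast; ring, HH_FF hq0 hq1]
    exact Finset.sum_nonneg fun i _ => mul_nonneg (pow_pos hq0 _).le (FF_nonneg hq0 hq1 _ _ _)
  refine ⟨hs.congr fun m => (term_eq hq0 n m).symm, ?_, ?_⟩
  · exact (summable_q_abs hq0 hq1 _ (exp1_ge hp4)).sub (summable_q_abs hq0 hq1 _ (exp2_ge hp4))
  · refine (tsum_congr fun m => term_eq hq0 n m).trans ?_
    rw [← ENNReal.ofReal_tsum_of_nonneg hnn hs, ENNReal.ofReal_eq_ofReal_iff (tsum_nonneg hnn) hR]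
      at ht
    refine ht.trans ?_
    push_cast
    rfl
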